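/- arXiv:1712.04781 — 5 statements merged into one kernel-verified Lean document; each statement's English description precedes it below -/
import Mathlib

section
/- Let G be a Grothendieck category and (𝒜, ℬ) a cotorsion pair in G such that 𝒜 is generating (every object of G is an epimorphic image of a coproduct of objects of 𝒜) and ℬ = S^{⊥1} for some set S of objects of G (i.e. ℬ = {Y : Ext^1(X,Y) = 0 for all X ∈ S}). Then the cotorsion pair (𝒜, ℬ) is complete: every object M of G fits into a short exact sequence 0 → M → B → A → 0 with A ∈ 𝒜 and B ∈ ℬ (a special ℬ-preenvelope), and into a short exact sequence 0 → B' → A' → M → 0 with A' ∈ 𝒜 and B' ∈ ℬ (a special 𝒜-precover). -/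
open CategoryTheory CategoryTheory.Limits CategoryTheory.Abelian ZeroObject

universe w' w v u

/-- There is a short exact sequence `0 → X → Y → Z → 0` in the abelian category `C`. -/
def IsShortExactSeq {C : Type u} [Category.{v} C] [Abelian C] (X Y Z : C) : Prop :=
  ∃ (f : X ⟶ Y) (g : Y ⟶ Z) (w : f ≫ g = 0), (ShortComplex.mk f g w).ShortExact

/-- `(𝒜, ℬ)` is a cotorsion pair in the abelian category `C`:
each class is the `Ext¹`-orthogonal of the other. -/
structure IsCotorsionPair (C : Type u) [Category.{v} C] [Abelian C] [HasExt.{w} C]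
    (𝒜 ℬ : Set C) : Prop where
  mem_left_iff : ∀ X : C, X ∈ 𝒜 ↔ ∀ B ∈ ℬ, Subsingleton (Abelian.Ext.{w} X B 1)
  mem_right_iff : ∀ Y : C, Y ∈ ℬ ↔ ∀ A ∈ 𝒜, Subsingleton (Abelian.Ext.{w} A Y 1)

/-- `(𝒜, ℬ)` is a complete cotorsion pair: every object has a special `ℬ`-preenvelope
`0 → M → B → A → 0` and a special `𝒜`-precover `0 → B' → A' → M → 0`. -/
structure IsCompleteCotorsionPair (C : Type u) [Category.{v} C] [Abelian C] [HasExt.{w} C]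
    (𝒜 ℬ : Set C) extends IsCotorsionPair C 𝒜 ℬ : Prop where
  preenvelope : ∀ M : C, ∃ B A, B ∈ ℬ ∧ A ∈ 𝒜 ∧ IsShortExactSeq M B A
  precover : ∀ M : C, ∃ B A, B ∈ ℬ ∧ A ∈ 𝒜 ∧ IsShortExactSeq B A M

/-- `(𝒜, ℬ)` is a complete hereditary cotorsion pair:
moreover `Ext^i(A, B) = 0` for all `A ∈ 𝒜`, `B ∈ ℬ` and `i ≥ 1`. -/
structure IsCompleteHereditaryCotorsionPair (C : Type u) [Category.{v} C] [Abelian C]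
    [HasExt.{w} C] (𝒜 ℬ : Set C) extends IsCompleteCotorsionPair C 𝒜 ℬ : Prop where
  hereditary : ∀ A ∈ 𝒜, ∀ B ∈ ℬ, ∀ i : ℕ, 1 ≤ i → Subsingleton (Abelian.Ext.{w} A B i)

namespace CategoryTheory

open MorphismProperty

section SmallObjectArgument

variable {C : Type u} [Category.{v} C] [Abelian C] [IsGrothendieckAbelian.{w} C]

/-- In a Grothendieck abelian category, any small family of monomorphisms permits
the small object argument. -/
lemma IsGrothendieckAbelian.hasSmallObjectArgument_of_le_monomorphisms
    (I : MorphismProperty C) [IsSmall.{w} I] (hI : I ≤ monomorphisms C) :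
    HasSmallObjectArgument.{w} I := by
  obtain ⟨κ, hκ', hκ⟩ := HasCardinalLT.exists_regular_cardinal_forall.{w}
    (fun i : I.toSet ↦ Subobject i.1.left)
  have : Fact κ.IsRegular := ⟨hκ'⟩
  have : Nonempty κ.ord.ToType := by simpa using hκ'.ne_zero
  have := WellFoundedLT.toOrderBot κ.ord.ToType
  exact ⟨κ, inferInstance, inferInstance,
    { preservesColimit {A B X Y} i hi f hf := by
        let hf' : (monomorphisms C).TransfiniteCompositionOfShape κ.ord.ToType f :=
          { toTransfiniteCompositionOfShape := hf.toTransfiniteCompositionOfShape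
            map_mem j hj := by
              have := (hf.attachCells j hj).pushouts_coproducts
              simp only [ofHoms_homFamily] at this
              refine (?_ : _ ≤ monomorphisms C) _ this
              simpa only [pushouts_le_iff, coproducts_le_iff] using hI }
        have (j j' : κ.ord.ToType) (φ : j ⟶ j') : Mono (hf'.F.map φ) := hf'.mem_map φ
        exact preservesColimit_coyoneda_obj_of_mono (Y := hf'.F) (κ := κ)
          (hκ ⟨Arrow.mk i, hi⟩) }⟩

end SmallObjectArgument

lemma IsSeparator.of_epi {C : Type u} [Category.{v} C] {G A : C} (hG : IsSeparator G)
    (p : A ⟶ G) [Epi p] : IsSeparator A := by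
  rw [isSeparator_def] at hG ⊢
  intro X Y f g h
  refine hG _ _ fun a ↦ ?_
  rw [← cancel_epi p]
  simpa using h (p ≫ a)

section Ext

variable {C : Type u} [Category.{v} C] [Abelian C] [HasExt.{w} C]

lemma ShortComplex.ShortExact.exists_lift_of_subsingleton_ext {T : ShortComplex C}
    (hT : T.ShortExact) {X : C} [Subsingleton (Abelian.Ext.{w} X T.X₁ 1)] (φ : X ⟶ T.X₃) :
    ∃ l : X ⟶ T.X₂, l ≫ T.g = φ := by
  obtain ⟨x, hx⟩ := Ext.covariant_sequence_exact₃ X hT (Ext.mk₀ φ) (zero_add 1)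
    (Subsingleton.elim _ _)
  obtain ⟨l, rfl⟩ := Ext.addEquiv₀.symm.surjective x
  exact ⟨l, Ext.addEquiv₀.symm.injective (by simpa using hx)⟩

lemma ShortComplex.ShortExact.exists_desc_of_subsingleton_ext {T : ShortComplex C}
    (hT : T.ShortExact) {Y : C} [Subsingleton (Abelian.Ext.{w} T.X₃ Y 1)] (φ : T.X₁ ⟶ Y) :
    ∃ h : T.X₂ ⟶ Y, T.f ≫ h = φ := by
  obtain ⟨x, hx⟩ := Ext.contravariant_sequence_exact₁ hT Y (Ext.mk₀ φ) (add_zero 1)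
    (Subsingleton.elim _ _)
  obtain ⟨l, rfl⟩ := Ext.addEquiv₀.symm.surjective x
  exact ⟨l, Ext.addEquiv₀.symm.injective (by simpa using hx)⟩

/-- A monomorphism with cokernel `Z` lifts against an epimorphism with kernel `Y` as soon as
`Ext¹(Z, Y) = 0`. -/
lemma ShortComplex.ShortExact.hasLiftingProperty {S T : ShortComplex C}
    (hS : S.ShortExact) (hT : T.ShortExact) [Subsingleton (Abelian.Ext.{w} S.X₃ T.X₁ 1)] :
    HasLiftingProperty S.f T.g where
  sq_hasLift {a b} sq := by
    have := hT.mono_f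
    obtain ⟨l, hl⟩ : ∃ l : S.X₂ ⟶ T.X₂, l ≫ T.g = b := by
      obtain ⟨z, hz⟩ := Ext.contravariant_sequence_exact₂ hS T.X₁
        ((Ext.mk₀ b).comp hT.extClass (zero_add 1)) (by
          rw [Ext.mk₀_comp_mk₀_assoc, ← sq.w, ← Ext.mk₀_comp_mk₀_assoc, hT.comp_extClass,
            Ext.comp_zero])
      obtain ⟨x, hx⟩ := Ext.covariant_sequence_exact₃ S.X₂ hT (Ext.mk₀ b) (zero_add 1)
        (by rw [← hz, Subsingleton.elim z 0, Ext.comp_zero])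
      obtain ⟨l, rfl⟩ := Ext.addEquiv₀.symm.surjective x
      exact ⟨l, Ext.addEquiv₀.symm.injective (by simpa using hx)⟩
    have hk : (a - S.f ≫ l) ≫ T.g = 0 := by simp [hl, sq.w]
    obtain ⟨h, hh⟩ := hS.exists_desc_of_subsingleton_ext (hT.exact.lift _ hk)
    exact ⟨⟨{ l := l + h ≫ T.f
              fac_left := by
                rw [Preadditive.comp_add, reassoc_of% hh, hT.exact.lift_f]
                abel
              fac_right := by simp [hl] }⟩⟩

/-- `Ext¹(X, Y) = 0` as soon as every morphism from `X` lifts along every epimorphism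
with kernel `Y`. -/
lemma subsingleton_ext_one_of_exists_lift [EnoughInjectives C] {X Y : C}
    (h : ∀ (E F : C) (i : Y ⟶ E) (p : E ⟶ F) (w : i ≫ p = 0),
      (ShortComplex.mk i p w).ShortExact → ∀ φ : X ⟶ F, ∃ l : X ⟶ E, l ≫ p = φ) :
    Subsingleton (Abelian.Ext.{w} X Y 1) := by
  refine subsingleton_of_forall_eq 0 fun e ↦ ?_
  let T := ShortComplex.mk (Injective.ι Y) (cokernel.π (Injective.ι Y)) (cokernel.condition _)
  have hT : T.ShortExact :=
    { exact := ShortComplex.exact_cokernel _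
      mono_f := inferInstanceAs (Mono (Injective.ι Y))
      epi_g := inferInstanceAs (Epi (cokernel.π _)) }
  obtain ⟨x, hx⟩ := Ext.covariant_sequence_exact₁ X hT e
    (Ext.eq_zero_of_injective (I := Injective.under Y) _) (zero_add 1)
  obtain ⟨φ, rfl⟩ := Ext.addEquiv₀.symm.surjective x
  obtain ⟨l, rfl⟩ := h _ _ _ _ _ hT φ
  rw [← hx]
  change (Ext.mk₀ (l ≫ T.g)).comp hT.extClass _ = 0
  rw [← Ext.mk₀_comp_mk₀_assoc, hT.comp_extClass, Ext.comp_zero]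

end Ext

section Separator

variable {C : Type u} [Category.{v} C] [HasCoproducts.{v} C]

/-- The morphism to `X` from the coproduct of copies of `A` indexed by a set of
morphisms `A ⟶ X`. -/
noncomputable abbrev sigmaDescSet {A X : C} (J : Set (A ⟶ X)) : (∐ fun _ : J ↦ A) ⟶ X :=
  Limits.Sigma.desc fun a ↦ a.1

lemma IsSeparator.epi_sigmaDescSet {A : C} (hA : IsSeparator A) {X P : C} (r : P ⟶ X) [Epi r] :
    Epi (sigmaDescSet {a : A ⟶ X | ∃ b : A ⟶ P, b ≫ r = a}) where
  left_cancellation g h hgh := by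
    rw [← cancel_epi r]
    refine (isSeparator_def _).1 hA _ _ fun b ↦ ?_
    have := Limits.Sigma.ι (fun _ : {a : A ⟶ X | ∃ b : A ⟶ P, b ≫ r = a} ↦ A) ⟨b ≫ r, b, rfl⟩ ≫= hgh
    simpa using this

/-- If `A` is a separator, `Ext¹(X, Y)` vanishes as soon as all morphisms to `Y` extend along
the kernels of the epimorphisms to `X` from coproducts of copies of `A` that are indexed by
sets of morphisms `A ⟶ X`. -/
lemma IsSeparator.subsingleton_ext_one [Abelian C] [HasExt.{w} C] [EnoughInjectives C] {A : C}
    (hA : IsSeparator A) {X Y : C}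
    (h : ∀ (J : Set (A ⟶ X)), Epi (sigmaDescSet J) → ∀ k : kernel (sigmaDescSet J) ⟶ Y,
      ∃ e, kernel.ι (sigmaDescSet J) ≫ e = k) :
    Subsingleton (Abelian.Ext.{w} X Y 1) := by
  refine subsingleton_ext_one_of_exists_lift fun E _ i p w hT φ ↦ ?_
  have : Epi p := hT.epi_g
  have : Mono i := hT.mono_f
  let J : Set (A ⟶ X) := {a | ∃ b : A ⟶ pullback p φ, b ≫ pullback.snd p φ = a}
  have hJ : Epi (sigmaDescSet J) := hA.epi_sigmaDescSet (pullback.snd p φ)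
  choose b hb using fun a : J ↦ a.2
  let s : (∐ fun _ : J ↦ A) ⟶ E := Limits.Sigma.desc fun a ↦ b a ≫ pullback.fst p φ
  have hs : s ≫ p = sigmaDescSet J ≫ φ := by
    ext a
    simp [s, pullback.condition, reassoc_of% hb a]
  have hk : (kernel.ι (sigmaDescSet J) ≫ s) ≫ p = 0 := by simp [hs]
  obtain ⟨e, he⟩ := h J hJ (hT.exact.lift _ hk)
  have hd : kernel.ι (sigmaDescSet J) ≫ (s - e ≫ i) = 0 := by
    rw [Preadditive.comp_sub, reassoc_of% he, hT.exact.lift_f, sub_self]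
  refine ⟨(ShortComplex.exact_kernel (sigmaDescSet J)).desc _ hd, ?_⟩
  rw [← cancel_epi (sigmaDescSet J), ← hs, (ShortComplex.exact_kernel _).g_desc_assoc]
  simp [w]

end Separator

end CategoryTheory

namespace IsCotorsionPair

section

variable {C : Type u} [Category.{v} C] [Abelian C]

/-- The epimorphisms whose kernel belongs to `ℬ`. -/
def epiWithKernelIn (ℬ : Set C) : MorphismProperty C := fun E _ p ↦
  ∃ Y ∈ ℬ, ∃ (i : Y ⟶ E) (w : i ≫ p = 0), (ShortComplex.mk i p w).ShortExact

lemma epiWithKernelIn_zero {ℬ : Set C} {Y Z : C} (hY : Y ∈ ℬ) (hZ : IsZero Z) (p : Y ⟶ Z) :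
    epiWithKernelIn ℬ p :=
  ⟨Y, hY, 𝟙 Y, hZ.eq_of_tgt _ _,
    { exact := (ShortComplex.exact_iff_epi _ (hZ.eq_of_tgt _ _)).2 (inferInstanceAs (Epi (𝟙 Y)))
      mono_f := inferInstanceAs (Mono (𝟙 Y))
      epi_g := ⟨fun _ _ _ ↦ hZ.eq_of_src _ _⟩ }⟩

variable [HasCoproducts.{v} C]

/-- A set of monomorphisms which generates a cotorsion pair `(𝒜, ℬ)` with `ℬ = S^{⊥₁}`, when
`A` is a separator which belongs to `𝒜`. -/
noncomputable def generatingMaps (A : C) (S : Set C) :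
    MorphismProperty C :=
  .ofHoms fun o : Option (Σ X : S, {J : Set (A ⟶ X.1) // Epi (sigmaDescSet J)}) ↦
    (o.elim (Arrow.mk (0 : 0 ⟶ A)) fun t ↦ Arrow.mk (kernel.ι (sigmaDescSet t.2.1))).hom

variable {A : C} {S : Set C}

lemma zero_mem_generatingMaps : generatingMaps A S (0 : 0 ⟶ A) :=
  .mk (none : Option (Σ X : S, {J : Set (A ⟶ X.1) // Epi (sigmaDescSet J)}))

lemma kernel_ι_mem_generatingMaps {X : C} (hX : X ∈ S) (J : Set (A ⟶ X))
    (hJ : Epi (sigmaDescSet J)) : generatingMaps A S (kernel.ι (sigmaDescSet J)) :=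
  .mk (some ⟨⟨X, hX⟩, ⟨J, hJ⟩⟩ :
    Option (Σ X : S, {J : Set (A ⟶ X.1) // Epi (sigmaDescSet J)}))

instance [Small.{v} S] : MorphismProperty.IsSmall.{v} (generatingMaps A S) := by
  have (X : C) : Small.{v} {J : Set (A ⟶ X) // Epi (sigmaDescSet J)} := inferInstance
  have : Small.{v} (Option (Σ X : S, {J : Set (A ⟶ X.1) // Epi (sigmaDescSet J)})) :=
    small_map (Equiv.optionEquivSumPUnit.{v} _)
  unfold generatingMaps
  infer_instance

lemma generatingMaps_le_monomorphisms :
    generatingMaps A S ≤ MorphismProperty.monomorphisms C := by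
  rintro _ _ _ ⟨_ | ⟨X, J, hJ⟩⟩
  · exact ⟨fun _ _ _ ↦ (isZero_zero C).eq_of_tgt _ _⟩
  · exact inferInstanceAs (Mono (kernel.ι (sigmaDescSet J)))

lemma mem_right_of_rlp [HasExt.{w} C] [EnoughInjectives C] {ℬ : Set C} (hA : IsSeparator A)
    (hS : ∀ Y : C, Y ∈ ℬ ↔ ∀ X ∈ S, Subsingleton (Abelian.Ext.{w} X Y 1))
    {T : ShortComplex C} (hT : T.Exact) [Mono T.f] (hg : (generatingMaps A S).rlp T.g) :
    T.X₁ ∈ ℬ := by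
  refine (hS _).2 fun X hX ↦ hA.subsingleton_ext_one fun J hJ k ↦ ?_
  have := hg _ (kernel_ι_mem_generatingMaps hX J hJ)
  have sq : CommSq (k ≫ T.f) (kernel.ι (sigmaDescSet J)) T.g 0 := ⟨by simp⟩
  exact ⟨hT.lift sq.lift sq.fac_right, by rw [← cancel_mono T.f]; simp⟩

lemma epi_of_rlp (hA : IsSeparator A) {E F : C} {p : E ⟶ F}
    (hp : (generatingMaps A S).rlp p) : Epi p where
  left_cancellation g h hgh := by
    refine (isSeparator_def _).1 hA _ _ fun a ↦ ?_
    have := hp _ zero_mem_generatingMaps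
    have sq : CommSq (0 : 0 ⟶ E) (0 : 0 ⟶ A) p a := ⟨by simp⟩
    rw [← sq.fac_right, Category.assoc, Category.assoc, hgh]

end

variable {C : Type u} [Category.{v} C] [Abelian C] [HasExt.{w} C] {𝒜 ℬ : Set C}

lemma llp_of_shortExact (hcp : IsCotorsionPair C 𝒜 ℬ) {T : ShortComplex C}
    (hT : T.ShortExact) (h₃ : T.X₃ ∈ 𝒜) : (epiWithKernelIn ℬ).llp T.f := by
  rintro E F p ⟨Y, hY, i, w, h⟩
  have := (hcp.mem_left_iff _).1 h₃ Y hY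
  exact hT.hasLiftingProperty h

lemma exists_lift (hcp : IsCotorsionPair C 𝒜 ℬ) {A E F : C} (hA : A ∈ 𝒜) {p : E ⟶ F}
    (hp : epiWithKernelIn ℬ p) (φ : A ⟶ F) : ∃ l : A ⟶ E, l ≫ p = φ := by
  obtain ⟨Y, hY, i, w, h⟩ := hp
  have := (hcp.mem_left_iff _).1 hA Y hY
  exact h.exists_lift_of_subsingleton_ext φ

lemma mem_left_of_exists_lift [EnoughInjectives C] (hcp : IsCotorsionPair C 𝒜 ℬ) {A : C}
    (h : ∀ ⦃E F : C⦄ (p : E ⟶ F), epiWithKernelIn ℬ p → ∀ φ : A ⟶ F, ∃ l, l ≫ p = φ) :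
    A ∈ 𝒜 :=
  (hcp.mem_left_iff A).2 fun Y hY ↦ subsingleton_ext_one_of_exists_lift
    fun _ _ i p w hT φ ↦ h p ⟨Y, hY, i, w, hT⟩ φ

lemma mem_left_of_isColimit [EnoughInjectives C] (hcp : IsCotorsionPair C 𝒜 ℬ) {ι : Type*}
    {f : ι → C} (hf : ∀ i, f i ∈ 𝒜) {c : Cofan f} (hc : IsColimit c) : c.pt ∈ 𝒜 := by
  refine hcp.mem_left_of_exists_lift fun E F p hp φ ↦ ?_
  choose l hl using fun i ↦ hcp.exists_lift (hf i) hp (c.inj i ≫ φ)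
  exact ⟨Cofan.IsColimit.desc hc l, Cofan.IsColimit.hom_ext hc _ _ fun i ↦ by simp [hl]⟩

lemma mem_right_of_injective (hcp : IsCotorsionPair C 𝒜 ℬ) (E : C) [Injective E] : E ∈ ℬ :=
  (hcp.mem_right_iff E).2 fun A _ ↦ Ext.subsingleton_of_injective A E 0

lemma mono_of_llp [EnoughInjectives C] (hcp : IsCotorsionPair C 𝒜 ℬ) {X Y : C} {f : X ⟶ Y}
    (hf : (epiWithKernelIn ℬ).llp f) : Mono f := by
  have := hf (0 : Injective.under X ⟶ 0)
    (epiWithKernelIn_zero (hcp.mem_right_of_injective _) (isZero_zero C) _)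
  have sq : CommSq (Injective.ι X) f (0 : Injective.under X ⟶ 0) 0 := ⟨by simp⟩
  exact mono_of_mono_fac sq.fac_left

lemma cokernel_mem_left_of_llp [EnoughInjectives C] (hcp : IsCotorsionPair C 𝒜 ℬ) {X Y : C}
    {f : X ⟶ Y} (hf : (epiWithKernelIn ℬ).llp f) : cokernel f ∈ 𝒜 := by
  refine hcp.mem_left_of_exists_lift fun E F p hp φ ↦ ?_
  have := hf p hp
  have sq : CommSq (0 : X ⟶ E) f p (cokernel.π f ≫ φ) := ⟨by simp⟩
  exact ⟨cokernel.desc f sq.lift sq.fac_left, by ext; simp⟩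

lemma mem_left_of_llp_of_isZero [EnoughInjectives C] (hcp : IsCotorsionPair C 𝒜 ℬ) {X Y : C}
    {f : X ⟶ Y} (hX : IsZero X) (hf : (epiWithKernelIn ℬ).llp f) : Y ∈ 𝒜 := by
  refine hcp.mem_left_of_exists_lift fun E F p hp φ ↦ ?_
  have := hf p hp
  have sq : CommSq (0 : X ⟶ E) f p φ := ⟨hX.eq_of_src _ _⟩
  exact ⟨sq.lift, sq.fac_right⟩

lemma generatingMaps_le_llp [HasCoproducts.{v} C] {A : C} {S : Set C}
    (hcp : IsCotorsionPair C 𝒜 ℬ) (hA : A ∈ 𝒜) (hS : S ⊆ 𝒜) :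
    generatingMaps A S ≤ (epiWithKernelIn ℬ).llp := by
  rintro _ _ _ ⟨_ | ⟨X, J, hJ⟩⟩
  · refine hcp.llp_of_shortExact (T := ShortComplex.mk (0 : 0 ⟶ A) (𝟙 A) (by simp)) ?_ hA
    exact { exact := (ShortComplex.exact_iff_mono _ rfl).2 (inferInstanceAs (Mono (𝟙 A)))
            mono_f := ⟨fun _ _ _ ↦ (isZero_zero C).eq_of_tgt _ _⟩
            epi_g := inferInstanceAs (Epi (𝟙 A)) }
  · refine hcp.llp_of_shortExact
      (T := ShortComplex.mk _ (sigmaDescSet J) (kernel.condition _)) ?_ (hS X.2)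
    exact { exact := ShortComplex.exact_kernel _
            mono_f := inferInstanceAs (Mono (kernel.ι (sigmaDescSet J)))
            epi_g := hJ }

end IsCotorsionPair

/-- a cotorsion pair `(𝒜, ℬ)` in a Grothendieck category with `𝒜` generating
and `ℬ = S^{⊥₁}` for a set `S` of objects is complete. -/
theorem stmt0 (C : Type u) [Category.{v} C] [Abelian C]
    -- `C` is a Grothendieck category:
    [HasFilteredColimits C] [AB5 C] [HasSeparator C]
    [HasExt.{w} C]
    (𝒜 ℬ : Set C) (hcp : IsCotorsionPair C 𝒜 ℬ)
    -- `𝒜` is generating: every object is an epimorphic image of a coproduct of objects of `𝒜`: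
    (hgen : ∀ M : C, ∃ (ι : Type v) (f : ι → C) (c : Cofan f),
      (∀ i, f i ∈ 𝒜) ∧ Nonempty (IsColimit c) ∧ ∃ p : c.pt ⟶ M, Epi p)
    -- `ℬ` is the right `Ext¹`-orthogonal of a (small) set `S` of objects:
    (S : Set C) (hsmall : Small.{v} S)
    (hS : ∀ Y : C, Y ∈ ℬ ↔ ∀ X ∈ S, Subsingleton (Abelian.Ext.{w} X Y 1)) :
    (∀ M : C, ∃ B A, B ∈ ℬ ∧ A ∈ 𝒜 ∧ IsShortExactSeq M B A) ∧
    (∀ M : C, ∃ B A, B ∈ ℬ ∧ A ∈ 𝒜 ∧ IsShortExactSeq B A M) := by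
  have : IsGrothendieckAbelian.{v} C := {}
  have hSA : S ⊆ 𝒜 := fun X hX ↦ (hcp.mem_left_iff X).2 fun Y hY ↦ (hS Y).1 hY X hX
  obtain ⟨ι, f, c, hf, ⟨hc⟩, q, _⟩ := hgen (separator C)
  have hA : c.pt ∈ 𝒜 := hcp.mem_left_of_isColimit hf hc
  have hA' : IsSeparator c.pt := (isSeparator_separator C).of_epi q
  let I := IsCotorsionPair.generatingMaps c.pt S
  have : I.HasSmallObjectArgument :=
    IsGrothendieckAbelian.hasSmallObjectArgument_of_le_monomorphisms.{v} I
      IsCotorsionPair.generatingMaps_le_monomorphisms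
  have hI : I.rlp.llp ≤ (IsCotorsionPair.epiWithKernelIn ℬ).llp :=
    MorphismProperty.antitone_llp ((MorphismProperty.le_llp_iff_le_rlp _ _).1
      (hcp.generatingMaps_le_llp hA hSA))
  refine ⟨fun M ↦ ?_, fun M ↦ ?_⟩
  · let d := MorphismProperty.factorizationData I.rlp.llp I.rlp (0 : M ⟶ 0)
    have hd := hI _ d.hi
    have : Mono d.i := hcp.mono_of_llp hd
    refine ⟨d.Z, cokernel d.i, ?_, hcp.cokernel_mem_left_of_llp hd, d.i, cokernel.π d.i,
      cokernel.condition _, { exact := ShortComplex.exact_cokernel _ }⟩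
    let T := ShortComplex.mk (𝟙 d.Z) d.p ((isZero_zero C).eq_of_tgt _ _)
    have : IsIso T.f := inferInstanceAs (IsIso (𝟙 d.Z))
    exact IsCotorsionPair.mem_right_of_rlp hA' hS (T := T)
      ((T.exact_iff_epi ((isZero_zero C).eq_of_tgt _ _)).2 inferInstance) d.hp
  · let d := MorphismProperty.factorizationData I.rlp.llp I.rlp (0 : 0 ⟶ M)
    have : Epi d.p := IsCotorsionPair.epi_of_rlp hA' d.hp
    exact ⟨kernel d.p, d.Z, IsCotorsionPair.mem_right_of_rlp hA' hS (ShortComplex.exact_kernel d.p) d.hp,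
      hcp.mem_left_of_llp_of_isZero (isZero_zero C) (hI _ d.hi), kernel.ι d.p, d.p,
      kernel.condition _, { exact := ShortComplex.exact_kernel _ }⟩
end

section
/- Let (𝒜, ℬ) be a complete hereditary cotorsion pair in a Grothendieck category G, let M ∈ 𝒜 have finite projective dimension (i.e. there is n with Ext^i(M, N) = 0 for all objects N and all i > n), and let Y be an acyclic unbounded cochain complex all of whose components Y^k lie in ℬ. Then every cycle object Z^j(Y) of Y satisfies Ext^i(M, Z^j(Y)) = 0 for all i ≥ 1. -/
open CategoryTheory CategoryTheory.Limits CategoryTheory.Abelian ZeroObject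

universe w' w v u

/-- In an acyclic cochain complex, the cycles fit into short exact sequences
`0 → Zⁱ(Y) → Yⁱ → Zʲ(Y) → 0` with `j = i + 1`. -/
lemma HomologicalComplex.ExactAt.shortExact_iCycles_toCycles {C : Type u} [Category.{v} C]
    [Abelian C] {Y : CochainComplex C ℤ} {i j : ℤ} (hj : Y.ExactAt j) (hij : i + 1 = j)
    (w : Y.iCycles i ≫ Y.toCycles i j = 0) :
    (ShortComplex.mk (Y.iCycles i) (Y.toCycles i j) w).ShortExact := by
  have hprev : (ComplexShape.up ℤ).prev j = i := (ComplexShape.up ℤ).prev_eq' hij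
  have hnext : (ComplexShape.up ℤ).next i = j := (ComplexShape.up ℤ).next_eq' hij
  have hepi : Epi (Y.toCycles i j) := by
    obtain rfl := hprev
    rw [Y.exactAt_iff] at hj
    have h : (Y.sc j).toCycles = Y.toCycles _ j :=
      (cancel_mono (Y.sc j).iCycles).1 ((Y.sc j).toCycles_i.trans (Y.toCycles_i _ j).symm)
    exact h ▸ hj.epi_toCycles
  let φ : ShortComplex.mk (Y.iCycles i) (Y.toCycles i j) w ⟶
      ShortComplex.mk (Y.iCycles i) (Y.d i j) (Y.iCycles_d i j) :=
    { τ₁ := 𝟙 _, τ₂ := 𝟙 _, τ₃ := Y.iCycles j }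
  have : Epi φ.τ₁ := inferInstanceAs (Epi (𝟙 _))
  have : IsIso φ.τ₂ := inferInstanceAs (IsIso (𝟙 _))
  have : Mono φ.τ₃ := inferInstanceAs (Mono (Y.iCycles j))
  exact
    { exact := (ShortComplex.exact_iff_of_epi_of_isIso_of_mono φ).2
        (ShortComplex.exact_of_f_is_kernel _ (Y.cyclesIsKernel i j hnext))
      mono_f := inferInstanceAs (Mono (Y.iCycles i))
      epi_g := hepi }

/-- Dimension shifting: if `Extⁱ(M, S.X₂)` and `Extⁱ⁺¹(M, S.X₁)` vanish, then so does
`Extⁱ(M, S.X₃)`. -/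
lemma CategoryTheory.ShortComplex.ShortExact.subsingleton_ext_X₃ {C : Type u} [Category.{v} C]
    [Abelian C] [HasExt.{w} C] {S : ShortComplex C} (hS : S.ShortExact) (M : C) (i : ℕ)
    [Subsingleton (Ext.{w} M S.X₂ i)] [Subsingleton (Ext.{w} M S.X₁ (i + 1))] :
    Subsingleton (Ext.{w} M S.X₃ i) := by
  refine subsingleton_of_forall_eq 0 fun x => ?_
  obtain ⟨y, rfl⟩ := Ext.covariant_sequence_exact₃ M hS x rfl (Subsingleton.elim _ _)
  rw [Subsingleton.elim y 0, Ext.zero_comp]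

/-- if `(𝒜, ℬ)` is a complete hereditary cotorsion pair in a Grothendieck
category, `M ∈ 𝒜` has finite projective dimension, and `Y` is an acyclic cochain complex
with components in `ℬ`, then `Ext^i(M, Z^j(Y)) = 0` for all `i ≥ 1`. -/
theorem stmt1 (C : Type u) [Category.{v} C] [Abelian C]
    [HasFilteredColimits C] [AB5 C] [HasSeparator C]
    [HasExt.{w} C]
    (𝒜 ℬ : Set C) (hcp : IsCompleteHereditaryCotorsionPair C 𝒜 ℬ)
    (M : C) (hM : M ∈ 𝒜)
    -- `M` has finite projective dimension:
    (hfpd : ∃ n : ℕ, ∀ (N : C) (i : ℕ), n < i → Subsingleton (Abelian.Ext.{w} M N i))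
    (Y : CochainComplex C ℤ)
    (hac : ∀ n : ℤ, Y.ExactAt n) (hcomp : ∀ n : ℤ, Y.X n ∈ ℬ) :
    ∀ (j : ℤ) (i : ℕ), 1 ≤ i → Subsingleton (Abelian.Ext.{w} M (Y.cycles j) i) := by
  obtain ⟨n, hn⟩ := hfpd
  have shift (k : ℕ) : ∀ (j : ℤ) (i : ℕ), 1 ≤ i → n < i + k →
      Subsingleton (Abelian.Ext.{w} M (Y.cycles j) i) := by
    induction k with
    | zero => exact fun j i _ h => hn _ i h
    | succ k ih =>
      intro j i hi h
      have w : Y.iCycles (j - 1) ≫ Y.toCycles (j - 1) j = 0 := by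
        rw [← cancel_mono (Y.iCycles j), Category.assoc, Y.toCycles_i, Y.iCycles_d, zero_comp]
      have hS := (hac j).shortExact_iCycles_toCycles (sub_add_cancel j 1) w
      have := hcp.hereditary M hM _ (hcomp (j - 1)) i hi
      have := ih (j - 1) (i + 1) (by omega) (by omega)
      exact hS.subsingleton_ext_X₃ M i
  exact fun j i hi => shift (n + 1) j i hi (by omega)
end

section
/- Let (𝒜, ℬ) be a complete hereditary cotorsion pair in a Grothendieck category G such that every object of 𝒜 has finite projective dimension. Then every acyclic unbounded cochain complex Y all of whose components lie in ℬ has all of its cycle objects Z^j(Y) in ℬ; that is, exℬ = ℬ~. -/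
open CategoryTheory CategoryTheory.Limits CategoryTheory.Abelian ZeroObject

universe w' w v u

/-- In an acyclic cochain complex, the cycles and the components form short exact sequences
`0 → Zⁱ → Kⁱ → Zʲ → 0` with `j = i + 1`. -/
lemma shortExact_iCycles_toCycles {C : Type u} [Category.{v} C] [Abelian C]
    (K : CochainComplex C ℤ) {i j : ℤ} (hij : i + 1 = j) (hK : K.ExactAt j) :
    (ShortComplex.mk (K.iCycles i) (K.toCycles i j) (by
      rw [← cancel_mono (K.iCycles j)]; simp)).ShortExact where
  exact := ShortComplex.exact_of_f_is_kernel _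
    (isKernelOfComp (K.iCycles j) (K.d i j) (K.cyclesIsKernel i j (by simp [hij])) _
      (K.toCycles_i i j))
  mono_f := inferInstanceAs (Mono (K.iCycles i))
  epi_g := Preadditive.epi_of_isZero_cokernel' _ (K.homologyIsCokernel i j (by simp [← hij]))
    hK.isZero_homology

/-- Dimension shifting along a short exact sequence `0 → X₁ → X₂ → X₃ → 0`. -/
lemma subsingleton_ext_of_shortExact {C : Type u} [Category.{v} C] [Abelian C] [HasExt.{w} C]
    {S : ShortComplex C} (hS : S.ShortExact) (A : C) (n : ℕ)
    (h₂ : Subsingleton (Abelian.Ext.{w} A S.X₂ n))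
    (h₁ : Subsingleton (Abelian.Ext.{w} A S.X₁ (n + 1))) :
    Subsingleton (Abelian.Ext.{w} A S.X₃ n) := by
  refine subsingleton_of_forall_eq 0 fun x => ?_
  obtain ⟨y, rfl⟩ := Ext.covariant_sequence_exact₃ A hS x rfl (Subsingleton.elim _ _)
  rw [Subsingleton.elim y 0, Ext.zero_comp]

/-- if `(𝒜, ℬ)` is a complete hereditary cotorsion pair in a Grothendieck
category and every object of `𝒜` has finite projective dimension, then every acyclic
cochain complex with components in `ℬ` has all its cycle objects in `ℬ` (`exℬ = ℬ~`). -/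
theorem stmt2 (C : Type u) [Category.{v} C] [Abelian C]
    [HasFilteredColimits C] [AB5 C] [HasSeparator C]
    [HasExt.{w} C]
    (𝒜 ℬ : Set C) (hcp : IsCompleteHereditaryCotorsionPair C 𝒜 ℬ)
    -- every object of `𝒜` has finite projective dimension:
    (hfpd : ∀ A ∈ 𝒜, ∃ n : ℕ, ∀ (N : C) (i : ℕ), n < i → Subsingleton (Abelian.Ext.{w} A N i))
    (Y : CochainComplex C ℤ)
    (hac : ∀ n : ℤ, Y.ExactAt n) (hcomp : ∀ n : ℤ, Y.X n ∈ ℬ) :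
    ∀ j : ℤ, Y.cycles j ∈ ℬ := by
  intro j
  rw [hcp.mem_right_iff]
  intro A hA
  obtain ⟨n, hn⟩ := hfpd A hA
  have shift (m i : ℕ) (hi : 1 ≤ i) (hm : n < i + m) (j : ℤ) :
      Subsingleton (Abelian.Ext.{w} A (Y.cycles j) i) := by
    induction m generalizing i j with
    | zero => exact hn _ _ hm
    | succ m ih =>
      exact subsingleton_ext_of_shortExact
        (shortExact_iCycles_toCycles Y (sub_add_cancel j 1) (hac j)) A i
        (hcp.hereditary A hA _ (hcomp _) i hi) (ih (i + 1) (by lia) (by lia) (j - 1))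
  exact shift n 1 le_rfl (by lia) j
end

section
/- Let (𝒜, ℬ) be a complete hereditary cotorsion pair in a Grothendieck category G, let N ∈ ℬ have finite injective dimension (i.e. there is n with Ext^i(M, N) = 0 for all objects M and all i > n), and let X be an acyclic unbounded cochain complex all of whose components lie in 𝒜. Then every cycle object Z^j(X) of X satisfies Ext^i(Z^j(X), N) = 0 for all i ≥ 1. -/
open CategoryTheory CategoryTheory.Limits CategoryTheory.Abelian ZeroObject

universe w' w v u

namespace CochainComplex

variable {C : Type u} [Category.{v} C] [Abelian C]

lemma epi_toCycles_of_exactAt (X : CochainComplex C ℤ) {j k : ℤ} (hjk : j + 1 = k)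
    (hk : X.ExactAt k) : Epi (X.toCycles j k) :=
  Preadditive.epi_of_isZero_cokernel' _
    (X.homologyIsCokernel j k (by simp [← hjk]))
    ((X.exactAt_iff_isZero_homology k).1 hk)

lemma shortExact_iCycles_toCycles (X : CochainComplex C ℤ) {j k : ℤ} (hjk : j + 1 = k)
    (hk : X.ExactAt k) :
    (ShortComplex.mk (X.iCycles j) (X.toCycles j k)
      (by simp [← cancel_mono (X.iCycles k)])).ShortExact := by
  have := X.epi_toCycles_of_exactAt hjk hk
  refine .mk' ?_ inferInstance this
  have hexact : (ShortComplex.mk (X.iCycles j) (X.d j k) (by simp)).Exact :=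
    ShortComplex.exact_of_f_is_kernel _ (X.cyclesIsKernel j k (by simp [← hjk]))
  let φ : ShortComplex.mk (X.iCycles j) (X.toCycles j k)
      (by simp [← cancel_mono (X.iCycles k)]) ⟶
      ShortComplex.mk (X.iCycles j) (X.d j k) (by simp) :=
    { τ₁ := 𝟙 _, τ₂ := 𝟙 _, τ₃ := X.iCycles k }
  have : Epi φ.τ₁ := inferInstanceAs (Epi (𝟙 _))
  have : IsIso φ.τ₂ := inferInstanceAs (IsIso (𝟙 _))
  have : Mono φ.τ₃ := inferInstanceAs (Mono (X.iCycles k))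
  exact (ShortComplex.exact_iff_of_epi_of_isIso_of_mono φ).2 hexact

/-- Dimension shifting along an acyclic complex with components `Ext`-orthogonal to `N`. -/
lemma subsingleton_ext_cycles_of_add [HasExt.{w} C] (X : CochainComplex C ℤ) (N : C)
    (hac : ∀ n : ℤ, X.ExactAt n)
    (hcomp : ∀ (n : ℤ) (i : ℕ), 1 ≤ i → Subsingleton (Abelian.Ext.{w} (X.X n) N i)) (m : ℕ) :
    ∀ (j : ℤ) (i : ℕ), 1 ≤ i →
      Subsingleton (Abelian.Ext.{w} (X.cycles (j + m)) N (i + m)) →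
      Subsingleton (Abelian.Ext.{w} (X.cycles j) N i) := by
  induction m with
  | zero => intro j i _ h; simpa using h
  | succ m ih =>
    intro j i hi h
    have h' : Subsingleton (Abelian.Ext.{w} (X.cycles (j + 1)) N (i + 1)) := by
      refine ih (j + 1) (i + 1) (by lia) ?_
      rwa [show j + 1 + (m : ℤ) = j + ((m + 1 : ℕ) : ℤ) by push_cast; ring,
        show i + 1 + m = i + (m + 1) by ring]
    have hS := X.shortExact_iCycles_toCycles (j := j) rfl (hac _)
    have := hcomp j i hi
    refine subsingleton_of_forall_eq 0 fun x ↦ ?_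
    obtain ⟨y, rfl⟩ := Abelian.Ext.contravariant_sequence_exact₁ hS N x (add_comm 1 i)
      (h'.elim _ _)
    rw [Subsingleton.elim y 0, Abelian.Ext.comp_zero]

end CochainComplex

/-- if `(𝒜, ℬ)` is a complete hereditary cotorsion pair in a Grothendieck
category, `N ∈ ℬ` has finite injective dimension, and `X` is an acyclic cochain complex
with components in `𝒜`, then `Ext^i(Z^j(X), N) = 0` for all `i ≥ 1`. -/
theorem stmt3 (C : Type u) [Category.{v} C] [Abelian C]
    [HasFilteredColimits C] [AB5 C] [HasSeparator C]
    [HasExt.{w} C]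
    (𝒜 ℬ : Set C) (hcp : IsCompleteHereditaryCotorsionPair C 𝒜 ℬ)
    (N : C) (hN : N ∈ ℬ)
    -- `N` has finite injective dimension:
    (hfid : ∃ n : ℕ, ∀ (M : C) (i : ℕ), n < i → Subsingleton (Abelian.Ext.{w} M N i))
    (X : CochainComplex C ℤ)
    (hac : ∀ n : ℤ, X.ExactAt n) (hcomp : ∀ n : ℤ, X.X n ∈ 𝒜) :
    ∀ (j : ℤ) (i : ℕ), 1 ≤ i → Subsingleton (Abelian.Ext.{w} (X.cycles j) N i) := by
  obtain ⟨n, hn⟩ := hfid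
  intro j i hi
  exact X.subsingleton_ext_cycles_of_add N hac
    (fun k l hl ↦ hcp.hereditary _ (hcomp k) N hN l hl) n j i hi (hn _ _ (by lia))
end

section
/- Let (𝒜, ℬ) be a complete hereditary cotorsion pair in a Grothendieck category G. Then the following are equivalent: (i) every acyclic unbounded cochain complex with all components in ℬ has all its cycle objects in ℬ (exℬ = ℬ~); (ii) for every cochain complex Y with all components in ℬ and every acyclic cochain complex X with all components and all cycle objects in 𝒜, every chain map X → Y is null-homotopic (dwℬ = dgℬ). -/
open CategoryTheory CategoryTheory.Limits CategoryTheory.Abelian ZeroObject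

universe w' w v u

section CotorsionPair

variable {C : Type u} [Category.{v} C] [Abelian C] [HasExt.{w} C]

lemma exists_lift_of_subsingleton_ext {S : ShortComplex C} (hS : S.ShortExact) {A : C}
    (hA : Subsingleton (Abelian.Ext.{w} A S.X₁ 1)) (g : A ⟶ S.X₃) :
    ∃ h : A ⟶ S.X₂, h ≫ S.g = g := by
  obtain ⟨x, hx⟩ := Ext.covariant_sequence_exact₃ A hS (Ext.mk₀ g) (zero_add 1)
    (Subsingleton.elim _ _)
  obtain ⟨h, rfl⟩ := (Ext.mk₀_bijective _ _).2 x
  exact ⟨h, (Ext.mk₀_bijective _ _).1 (by simpa using hx)⟩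

lemma exists_extension_of_subsingleton_ext {S : ShortComplex C} (hS : S.ShortExact) {B : C}
    (hB : Subsingleton (Abelian.Ext.{w} S.X₃ B 1)) (g : S.X₁ ⟶ B) :
    ∃ h : S.X₂ ⟶ B, S.f ≫ h = g := by
  obtain ⟨x, hx⟩ := Ext.contravariant_sequence_exact₁ hS B (Ext.mk₀ g) (add_zero 1)
    (Subsingleton.elim _ _)
  obtain ⟨h, rfl⟩ := (Ext.mk₀_bijective _ _).2 x
  exact ⟨h, (Ext.mk₀_bijective _ _).1 (by simpa using hx)⟩

lemma subsingleton_ext_X₁_of_exists_lift {S : ShortComplex C} (hS : S.ShortExact) {A : C}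
    (hA : Subsingleton (Abelian.Ext.{w} A S.X₂ 1))
    (hl : ∀ g : A ⟶ S.X₃, ∃ h : A ⟶ S.X₂, h ≫ S.g = g) :
    Subsingleton (Abelian.Ext.{w} A S.X₁ 1) := by
  refine subsingleton_of_forall_eq 0 fun x ↦ ?_
  obtain ⟨y, rfl⟩ := Ext.covariant_sequence_exact₁ A hS x (Subsingleton.elim _ _) (zero_add 1)
  obtain ⟨g, rfl⟩ := (Ext.mk₀_bijective _ _).2 y
  obtain ⟨h, rfl⟩ := hl g
  rw [← Ext.mk₀_comp_mk₀, Ext.comp_assoc _ _ _ (zero_add 0) (zero_add 1) (by simp),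
    hS.comp_extClass, Ext.comp_zero]

namespace IsCotorsionPair

variable {𝒜 ℬ : Set C} (h : IsCotorsionPair C 𝒜 ℬ)
include h

lemma subsingleton_ext {A B : C} (hA : A ∈ 𝒜) (hB : B ∈ ℬ) :
    Subsingleton (Abelian.Ext.{w} A B 1) :=
  (h.mem_left_iff A).1 hA B hB

lemma left_of_iso {X X' : C} (e : X ≅ X') (hX : X ∈ 𝒜) : X' ∈ 𝒜 := by
  rw [h.mem_left_iff]
  intro B hB
  have := h.subsingleton_ext hX hB
  refine subsingleton_of_forall_eq 0 fun x ↦ ?_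
  have : (Ext.mk₀ e.inv).comp ((Ext.mk₀ e.hom).comp x (zero_add 1)) (zero_add 1) = x := by simp
  rw [← this, Subsingleton.elim ((Ext.mk₀ e.hom).comp x (zero_add 1)) 0, Ext.comp_zero]

lemma left_of_isZero {X : C} (hX : IsZero X) : X ∈ 𝒜 := by
  rw [h.mem_left_iff]
  exact fun B _ ↦ subsingleton_of_forall_eq 0 fun x ↦ by
    have : Projective X := hX.projective
    exact Ext.eq_zero_of_projective x

lemma right_of_injective {X : C} [Injective X] : X ∈ ℬ := by
  rw [h.mem_right_iff]
  exact fun A _ ↦ Ext.subsingleton_of_injective A X 0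

lemma right_X₂ {S : ShortComplex C} (hS : S.ShortExact) (h₁ : S.X₁ ∈ ℬ) (h₃ : S.X₃ ∈ ℬ) :
    S.X₂ ∈ ℬ := by
  rw [h.mem_right_iff]
  intro A hA
  have := h.subsingleton_ext hA h₁
  have := h.subsingleton_ext hA h₃
  refine subsingleton_of_forall_eq 0 fun x ↦ ?_
  obtain ⟨y, rfl⟩ := Ext.covariant_sequence_exact₂ A hS x (Subsingleton.elim _ _)
  rw [Subsingleton.elim y 0, Ext.zero_comp]

end IsCotorsionPair

lemma IsCompleteHereditaryCotorsionPair.left_X₁ {𝒜 ℬ : Set C}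
    (h : IsCompleteHereditaryCotorsionPair C 𝒜 ℬ) {S : ShortComplex C} (hS : S.ShortExact)
    (h₂ : S.X₂ ∈ 𝒜) (h₃ : S.X₃ ∈ 𝒜) : S.X₁ ∈ 𝒜 := by
  rw [h.mem_left_iff]
  intro B hB
  have := h.subsingleton_ext h₂ hB
  have := h.hereditary _ h₃ _ hB 2 (by simp)
  refine subsingleton_of_forall_eq 0 fun x ↦ ?_
  obtain ⟨y, rfl⟩ := Ext.contravariant_sequence_exact₁ hS B x (by rfl) (Subsingleton.elim _ _)
  rw [Subsingleton.elim y 0, Ext.comp_zero]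

end CotorsionPair

lemma exists_int_sequence {S : ℤ → Type*} (R : ∀ m m' : ℤ, m + 1 = m' → S m → S m' → Prop)
    (up : ∀ m (s : S m), ∃ t, R m (m + 1) rfl s t)
    (down : ∀ m (t : S (m + 1)), ∃ s, R m (m + 1) rfl s t) (n : ℤ) (s₀ : S n) :
    ∃ σ : ∀ m, S m, σ n = s₀ ∧ ∀ m m' h, R m m' h (σ m) (σ m') := by
  have down' : ∀ m (t : S m), ∃ s, R (m - 1) m (by lia) s t := fun m t ↦ by
    have : ∀ k (h : k + 1 = m), ∃ s, R k m h s t := by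
      rintro k rfl
      exact down k t
    exact this _ _
  choose u hu using up
  choose d hd using down'
  let σ : ∀ m, S m := fun m ↦ m.inductionOn' n s₀ (fun k _ ↦ u k) (fun k _ ↦ d k)
  refine ⟨σ, Int.inductionOn'_self, fun m m' h ↦ ?_⟩
  by_cases hm : n ≤ m
  · subst h
    have : σ (m + 1) = u m (σ m) := Int.inductionOn'_add_one hm
    exact this ▸ hu m (σ m)
  · obtain rfl : m = m' - 1 := by lia
    have : σ (m' - 1) = d m' (σ m') := Int.inductionOn'_sub_one (by lia)
    exact this ▸ hd m' (σ m')

section Cycles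

variable {C : Type u} [Category.{v} C] [Abelian C]

lemma CochainComplex.shortExact_cycles (K : CochainComplex C ℤ) (n m : ℤ) (h : n + 1 = m)
    (hK : K.ExactAt m) :
    (ShortComplex.mk (K.iCycles n) (K.toCycles n m)
      (by simp [← cancel_mono (K.iCycles m)])).ShortExact := by
  have : Epi (K.toCycles n m) := by
    rw [K.exactAt_iff_isZero_homology] at hK
    exact Preadditive.epi_of_isZero_cokernel' _ (K.homologyIsCokernel n m (by simp [← h])) hK
  have hk : (ShortComplex.mk (K.iCycles n) (K.d n m) (by simp)).Exact :=
    ShortComplex.exact_of_f_is_kernel _ (K.cyclesIsKernel n m (by simp [h]))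
  refine { exact := ?_ }
  let φ : ShortComplex.mk (K.iCycles n) (K.toCycles n m)
      (by simp [← cancel_mono (K.iCycles m)]) ⟶
      ShortComplex.mk (K.iCycles n) (K.d n m) (by simp) :=
    { τ₁ := 𝟙 _, τ₂ := 𝟙 _, τ₃ := K.iCycles m }
  have : IsIso φ.τ₂ := inferInstanceAs (IsIso (𝟙 _))
  have : Epi φ.τ₁ := inferInstanceAs (Epi (𝟙 _))
  have : Mono φ.τ₃ := inferInstanceAs (Mono (K.iCycles m))
  exact (ShortComplex.exact_iff_of_epi_of_isIso_of_mono φ).2 hk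

lemma CochainComplex.exists_splice {A X : ℤ → C} (i : ∀ n, A n ⟶ X n)
    (p : ∀ n, X n ⟶ A (n + 1)) (w : ∀ n, i n ≫ p n = 0) :
    ∃ (K : CochainComplex C ℤ) (e : ∀ n, K.X n ≅ X n),
      ∀ n, K.d n (n + 1) = (e n).hom ≫ p n ≫ i (n + 1) ≫ (e (n + 1)).inv :=
  ⟨CochainComplex.of X (fun n ↦ p n ≫ i (n + 1)) (fun n ↦ by simp [reassoc_of% (w (n + 1))]),
    fun n ↦ Iso.refl _, fun n ↦ (CochainComplex.of_d X (fun n ↦ p n ≫ i (n + 1)) n).trans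
      (((congrArg (p n ≫ ·) (Category.comp_id _)).symm).trans (Category.id_comp _).symm)⟩

section

variable {A : ℤ → C} {K : CochainComplex C ℤ} (i : ∀ n, A n ⟶ K.X n)
  (p : ∀ n, K.X n ⟶ A (n + 1)) (w : ∀ n, i n ≫ p n = 0)
  (hS : ∀ n, (ShortComplex.mk (i n) (p n) (w n)).ShortExact)
  (hd : ∀ n, K.d n (n + 1) = p n ≫ i (n + 1))

include hS

lemma CochainComplex.exact_of_splice (n : ℤ) :
    (ShortComplex.mk (i n) (K.d n (n + 1))
      (by rw [hd, reassoc_of% (w n), zero_comp])).Exact := by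
  let φ : ShortComplex.mk (i n) (p n) (w n) ⟶ ShortComplex.mk (i n) (K.d n (n + 1))
      (by rw [hd, reassoc_of% (w n), zero_comp]) :=
    { τ₁ := 𝟙 _, τ₂ := 𝟙 _, τ₃ := i (n + 1), comm₂₃ := by simp [hd] }
  have : IsIso φ.τ₂ := inferInstanceAs (IsIso (𝟙 _))
  have : Epi φ.τ₁ := inferInstanceAs (Epi (𝟙 _))
  have : Mono φ.τ₃ := (hS (n + 1)).mono_f
  exact (ShortComplex.exact_iff_of_epi_of_isIso_of_mono φ).1 (hS n).exact

include hd

lemma CochainComplex.exactAt_of_splice (n : ℤ) : K.ExactAt n := by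
  obtain ⟨n, rfl⟩ : ∃ k, n = k + 1 := ⟨n - 1, by simp⟩
  rw [K.exactAt_iff' n (n + 1) (n + 1 + 1) (by simp) (by simp)]
  let φ : ShortComplex.mk (K.d n (n + 1)) (K.d (n + 1) (n + 1 + 1)) (by simp) ⟶
      ShortComplex.mk (i (n + 1)) (K.d (n + 1) (n + 1 + 1))
      (by rw [hd, reassoc_of% (w (n + 1)), zero_comp]) :=
    { τ₁ := p n, τ₂ := 𝟙 _, τ₃ := 𝟙 _, comm₁₂ := by simp [hd] }
  have : IsIso φ.τ₂ := inferInstanceAs (IsIso (𝟙 _))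
  have : Epi φ.τ₁ := (hS n).epi_g
  have : Mono φ.τ₃ := inferInstanceAs (Mono (𝟙 _))
  exact (ShortComplex.exact_iff_of_epi_of_isIso_of_mono φ).2
    (exact_of_splice i p w hS hd (n + 1))

lemma CochainComplex.nonempty_cycles_iso_of_splice (n : ℤ) :
    Nonempty (A n ≅ K.cycles n) := by
  have : Mono (ShortComplex.mk (i n) (K.d n (n + 1))
      (by rw [hd, reassoc_of% (w n), zero_comp])).f := (hS n).mono_f
  exact ⟨IsLimit.conePointUniqueUpToIso (exact_of_splice i p w hS hd n).fIsKernel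
    (K.cyclesIsKernel n (n + 1) (by simp))⟩

end

end Cycles

section

variable {C : Type u} [Category.{v} C] [Abelian C]

/-- A morphism from an object of `𝒜` to the cycles of `Y` in degree `m`. -/
structure MapToCycles (𝒜 : Set C) (Y : CochainComplex C ℤ) (m : ℤ) where
  /-- the source object -/
  obj : C
  mem : obj ∈ 𝒜
  /-- the morphism to the cycles -/
  hom : obj ⟶ Y.cycles m

/-- A short exact sequence `0 → s.obj → X → t.obj → 0` with `X ∈ 𝒜` which maps to the sequence
`Y.cycles m → Y.X m → Y.cycles m'`. -/
structure MapToCycles.Extension {𝒜 : Set C} {Y : CochainComplex C ℤ} {m m' : ℤ}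
    (s : MapToCycles 𝒜 Y m) (t : MapToCycles 𝒜 Y m') where
  /-- the middle object -/
  X : C
  mem : X ∈ 𝒜
  /-- the inclusion -/
  i : s.obj ⟶ X
  /-- the projection -/
  p : X ⟶ t.obj
  w : i ≫ p = 0
  shortExact : (ShortComplex.mk i p w).ShortExact
  /-- the morphism between the middle objects -/
  φ : X ⟶ Y.X m
  comm_i : i ≫ φ = s.hom ≫ Y.iCycles m
  comm_p : φ ≫ Y.toCycles m m' = p ≫ t.hom

variable [HasExt.{w} C] {𝒜 ℬ : Set C} (hcp : IsCompleteHereditaryCotorsionPair C 𝒜 ℬ)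

include hcp

lemma MapToCycles.exists_up {Y : CochainComplex C ℤ} {m : ℤ} (s : MapToCycles 𝒜 Y m) :
    ∃ t : MapToCycles 𝒜 Y (m + 1), Nonempty (s.Extension t) := by
  have hS : (ShortComplex.mk (𝟙 s.obj) (0 : s.obj ⟶ 0) (by simp)).ShortExact :=
    { exact := (ShortComplex.exact_iff_epi _ rfl).2 (by dsimp; infer_instance)
      mono_f := by dsimp; infer_instance
      epi_g := (isZero_zero C).epi _ }
  exact ⟨{ obj := 0, mem := hcp.left_of_isZero (isZero_zero C), hom := 0 }, ⟨{
    X := s.obj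
    mem := s.mem
    i := 𝟙 _
    p := 0
    w := by simp
    shortExact := hS
    φ := s.hom ≫ Y.iCycles m
    comm_i := by simp
    comm_p := by simp [← cancel_mono (Y.iCycles (m + 1))] }⟩⟩

lemma MapToCycles.exists_down {Y : CochainComplex C ℤ} {m : ℤ} (hY : Y.ExactAt (m + 1))
    (t : MapToCycles 𝒜 Y (m + 1)) :
    ∃ s : MapToCycles 𝒜 Y m, Nonempty (s.Extension t) := by
  have hS := Y.shortExact_cycles m (m + 1) rfl hY
  have : Epi (Y.toCycles m (m + 1)) := hS.epi_g
  obtain ⟨B, A, hB, hA, f, g, w, h⟩ := hcp.precover (pullback t.hom (Y.toCycles m (m + 1)))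
  have : Epi g := h.epi_g
  let p := g ≫ pullback.fst t.hom (Y.toCycles m (m + 1))
  have hp : (ShortComplex.mk (kernel.ι p) p (kernel.condition p)).ShortExact :=
    { exact := ShortComplex.exact_kernel p }
  refine ⟨{
    obj := kernel p
    mem := hcp.left_X₁ hp hA t.mem
    hom := Y.liftCycles (kernel.ι p ≫ g ≫ pullback.snd _ _) (m + 1) (by simp) (by
      rw [← Y.toCycles_i m (m + 1)]
      simp only [Category.assoc]
      rw [← pullback.condition_assoc]
      simpa [p] using kernel.condition_assoc p (t.hom ≫ Y.iCycles (m + 1))) }, ⟨{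
    X := A
    mem := hA
    i := kernel.ι p
    p := p
    w := by simp
    shortExact := hp
    φ := g ≫ pullback.snd _ _
    comm_i := by simp
    comm_p := by simp [p, pullback.condition] }⟩⟩

lemma cycles_mem_right_of_nullhomotopic {Y : CochainComplex C ℤ} (hY : ∀ n, Y.ExactAt n)
    (hYB : ∀ n, Y.X n ∈ ℬ)
    (H : ∀ X : CochainComplex C ℤ, (∀ n : ℤ, X.ExactAt n) → (∀ n : ℤ, X.X n ∈ 𝒜) →
        (∀ n : ℤ, X.cycles n ∈ 𝒜) → ∀ f : X ⟶ Y, Nonempty (Homotopy f 0)) (n : ℤ) :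
    Y.cycles n ∈ ℬ := by
  rw [hcp.mem_right_iff]
  intro A hA
  refine subsingleton_ext_X₁_of_exists_lift (Y.shortExact_cycles n (n + 1) rfl (hY _))
    (hcp.subsingleton_ext hA (hYB n)) fun g ↦ ?_
  obtain ⟨σ, hσ, hR⟩ := exists_int_sequence (S := MapToCycles 𝒜 Y)
    (fun _ _ _ s t ↦ Nonempty (s.Extension t))
    (fun _ s ↦ s.exists_up hcp) (fun _ t ↦ t.exists_down hcp (hY _)) (n + 1)
    { obj := A, mem := hA, hom := g }
  let e (m : ℤ) : (σ m).Extension (σ (m + 1)) := (hR m (m + 1) rfl).some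
  obtain ⟨X, ε, hX⟩ := CochainComplex.exists_splice (fun m ↦ (e m).i) (fun m ↦ (e m).p)
    (fun m ↦ (e m).w)
  let ι (m : ℤ) : (σ m).obj ⟶ X.X m := (e m).i ≫ (ε m).inv
  let π (m : ℤ) : X.X m ⟶ (σ (m + 1)).obj := (ε m).hom ≫ (e m).p
  have w (m : ℤ) : ι m ≫ π m = 0 := by simp [ι, π, (e m).w]
  have hS (m : ℤ) : (ShortComplex.mk (ι m) (π m) (w m)).ShortExact :=
    ShortComplex.shortExact_of_iso
      (ShortComplex.isoMk (S₁ := .mk _ _ (e m).w) (Iso.refl _) (ε m).symm (Iso.refl _)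
        (by simp [ι]) (by simp [π])) (e m).shortExact
  have hd (m : ℤ) : X.d m (m + 1) = π m ≫ ι (m + 1) := by simp [hX, ι, π]
  let f : X ⟶ Y :=
    { f m := (ε m).hom ≫ (e m).φ
      comm' := by
        rintro m _ rfl
        rw [hX, ← Y.toCycles_i, Category.assoc, reassoc_of% (e m).comm_p]
        simp [(e (m + 1)).comm_i] }
  obtain ⟨h⟩ := H X (CochainComplex.exactAt_of_splice ι π w hS hd)
    (fun m ↦ hcp.left_of_iso (ε m).symm (e m).mem)
    (fun m ↦ hcp.left_of_iso
      (CochainComplex.nonempty_cycles_iso_of_splice ι π w hS hd m).some (σ m).mem) f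
  suffices ∃ k : (σ (n + 1)).obj ⟶ Y.X n, k ≫ Y.toCycles n (n + 1) = (σ (n + 1)).hom by
    rw [hσ] at this
    exact this
  refine ⟨ι (n + 1) ≫ h.hom (n + 1) n, ?_⟩
  have h₁ := h.comm (n + 1)
  rw [dNext_eq h.hom (i' := n + 1 + 1) rfl, prevD_eq h.hom (j' := n) rfl,
    HomologicalComplex.zero_f, add_zero, hd] at h₁
  have h₂ := congrArg (fun q ↦ ι (n + 1) ≫ q) h₁
  simp only [Preadditive.comp_add, Category.assoc, reassoc_of% (w (n + 1)), zero_comp,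
    zero_add] at h₂
  rw [← cancel_mono (Y.iCycles _), Category.assoc, Category.assoc, Y.toCycles_i, ← h₂]
  simp [f, ι, (e (n + 1)).comm_i]

end

section

variable {C : Type u} [Category.{v} C] [Abelian C] [HasExt.{w} C] {𝒜 ℬ : Set C}

lemma IsCotorsionPair.nonempty_homotopy_zero (hcp : IsCotorsionPair C 𝒜 ℬ)
    {X N : CochainComplex C ℤ} (hX : ∀ n, X.ExactAt n) (hXA : ∀ n, X.cycles n ∈ 𝒜)
    (hN : ∀ n, N.ExactAt n) (hNB : ∀ n, N.cycles n ∈ ℬ) (f : X ⟶ N) :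
    Nonempty (Homotopy f 0) := by
  have hN' (n : ℤ) : N.X n ∈ ℬ :=
    hcp.right_X₂ (N.shortExact_cycles n (n + 1) rfl (hN _)) (hNB n) (hNB _)
  have lift (n i j : ℤ) (hij : j + 1 = i) (g : X.cycles n ⟶ N.X i)
      (hg : g ≫ N.d i (i + 1) = 0) : ∃ e : X.cycles n ⟶ N.X j, e ≫ N.d j i = g := by
    obtain ⟨e, he⟩ := exists_lift_of_subsingleton_ext (N.shortExact_cycles j i hij (hN _))
      (hcp.subsingleton_ext (hXA n) (hNB j)) (N.liftCycles g (i + 1) (by simp) hg)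
    refine ⟨e, ?_⟩
    dsimp at he
    rw [← N.toCycles_i, reassoc_of% he, N.liftCycles_i]
  have hb (i j : ℤ) (hij : j + 1 = i) :
      ∃ b : X.X i ⟶ N.X j, X.iCycles i ≫ b ≫ N.d j i = X.iCycles i ≫ f.f i := by
    obtain ⟨a, ha⟩ := lift i i j hij (X.iCycles i ≫ f.f i) (by simp)
    obtain ⟨b, hb⟩ := exists_extension_of_subsingleton_ext
      (X.shortExact_cycles i (i + 1) rfl (hX _)) (hcp.subsingleton_ext (hXA _) (hN' j)) a
    dsimp at hb
    exact ⟨b, by rw [reassoc_of% hb, ha]⟩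
  choose b hb using hb
  have he (i j k : ℤ) (hij : j + 1 = i) (hik : i + 1 = k) : ∃ e : X.cycles k ⟶ N.X j,
      X.toCycles i k ≫ e ≫ N.d j i = f.f i - b i j hij ≫ N.d j i - X.d i k ≫ b k i hik := by
    subst hik
    have hS := X.shortExact_cycles i (i + 1) rfl (hX _)
    have : Epi (X.toCycles i (i + 1)) := hS.epi_g
    let r := f.f i - b i j hij ≫ N.d j i - X.d i (i + 1) ≫ b (i + 1) i rfl
    have hr : X.iCycles i ≫ r = 0 := by simp [r, hb]
    have hr' : r ≫ N.d i (i + 1) = 0 := by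
      have := X.toCycles i (i + 1) ≫= hb (i + 1) i rfl
      simp only [X.toCycles_i_assoc] at this
      simp [r, this]
    have hc : X.toCycles i (i + 1) ≫ hS.exact.desc r hr = r := hS.exact.g_desc r hr
    obtain ⟨e, he⟩ := lift (i + 1) i j hij (hS.exact.desc r hr) (by
      rw [← cancel_epi (X.toCycles i (i + 1)), reassoc_of% hc, hr', comp_zero])
    exact ⟨e, by rw [he, hc]⟩
  choose e he using he
  let s (i j : ℤ) (hij : (ComplexShape.up ℤ).Rel j i) : X.X i ⟶ N.X j :=
    b i j hij + X.toCycles i (i + 1) ≫ e i j (i + 1) hij rfl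
  have hf : f = Homotopy.nullHomotopicMap' s := by
    ext i
    obtain ⟨j, rfl⟩ : ∃ k, i = k + 1 := ⟨i - 1, by simp⟩
    rw [Homotopy.nullHomotopicMap'_f (k₂ := j) (k₁ := j + 1) (k₀ := j + 1 + 1) rfl rfl]
    have h₀ : X.d (j + 1) (j + 1 + 1) ≫ X.toCycles (j + 1 + 1) (j + 1 + 1 + 1) = 0 := by simp
    simp only [s, Preadditive.comp_add, Preadditive.add_comp, Category.assoc, he,
      reassoc_of% h₀, zero_comp]
    abel
  rw [hf]
  exact ⟨Homotopy.nullHomotopy' s⟩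

end

section

variable {C : Type u} [Category.{v} C] [Abelian C] [IsGrothendieckAbelian.{w} C]

open MorphismProperty

/-- A small family of monomorphisms in a Grothendieck abelian category permits the small
object argument. -/
lemma IsGrothendieckAbelian.hasSmallObjectArgument_ofHoms {ι : Type*} [Small.{w} ι]
    {A B : ι → C} (i : ∀ k, A k ⟶ B k) [∀ k, Mono (i k)] :
    HasSmallObjectArgument.{w} (ofHoms i) := by
  obtain ⟨κ, hκ', hκ⟩ :=
    HasCardinalLT.exists_regular_cardinal_forall.{w} (fun k ↦ Subobject (A k))
  have : Fact κ.IsRegular := ⟨hκ'⟩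
  have : Nonempty κ.ord.ToType := by simpa using hκ'.ne_zero
  have := WellFoundedLT.toOrderBot κ.ord.ToType
  have hi : ofHoms i ≤ monomorphisms C := by
    rintro _ _ _ ⟨k⟩
    exact inferInstanceAs (Mono (i k))
  exact ⟨κ, inferInstance, inferInstance,
    { preservesColimit {A B X Y} j hj f hf := by
        let hf' : (monomorphisms C).TransfiniteCompositionOfShape κ.ord.ToType f :=
          { toTransfiniteCompositionOfShape := hf.toTransfiniteCompositionOfShape
            map_mem j hj := by
              have := (hf.attachCells j hj).pushouts_coproducts
              simp only [ofHoms_homFamily] at this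
              refine (?_ : _ ≤ monomorphisms C) _ this
              simpa only [pushouts_le_iff, coproducts_le_iff] }
        have (j j' : κ.ord.ToType) (φ : j ⟶ j') : Mono (hf'.F.map φ) := hf'.mem_map φ
        obtain ⟨k⟩ := hj
        exact IsGrothendieckAbelian.preservesColimit_coyoneda_obj_of_mono
          (Y := hf'.F) (κ := κ) (hκ k) }⟩

lemma IsGrothendieckAbelian.mono_of_llp_rlp {I : MorphismProperty C}
    [HasSmallObjectArgument.{w} I] (hI : I ≤ monomorphisms C) {X Y : C} (f : X ⟶ Y)
    (hf : I.rlp.llp f) : Mono f := by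
  rw [llp_rlp_of_hasSmallObjectArgument] at hf
  have : (transfiniteCompositions.{w} (coproducts.{w} I).pushouts).retracts ≤
      monomorphisms C := by
    trans (transfiniteCompositions.{w} (coproducts.{w} (monomorphisms C)).pushouts).retracts
    · apply retracts_monotone
      apply transfiniteCompositions_monotone
      apply pushouts_monotone
      apply coproducts_monotone
      exact hI
    · simp
  exact this _ hf

end

section

variable {C : Type u} [Category.{v} C] [Abelian C]

/-- The complex with two copies of `X` in degrees `n` and `n + 1`, and the identity as the
differential between them. -/
noncomputable def disk (X : C) (n : ℤ) : CochainComplex C ℤ :=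
  HomologicalComplex.double (𝟙 X) (show (ComplexShape.up ℤ).Rel n (n + 1) from rfl)

namespace disk

/-- The object `X` identifies to the component of `disk X n` in degree `n`. -/
noncomputable def isoX (X : C) (n : ℤ) : X ≅ (disk X n).X n :=
  (HomologicalComplex.doubleXIso₀ _ _).symm

lemma isZero_X (X : C) (n k : ℤ) (h₀ : k ≠ n) (h₁ : k ≠ n + 1) : IsZero ((disk X n).X k) :=
  HomologicalComplex.isZero_double_X _ _ k h₀ h₁

instance (X : C) (n : ℤ) : IsIso ((disk X n).d n (n + 1)) := by
  rw [disk, HomologicalComplex.double_d _ _ (by simp)]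
  infer_instance

/-- The morphism from `disk X n` induced by a morphism to the component in degree `n`. -/
noncomputable def desc {X : C} {n : ℤ} {K : CochainComplex C ℤ} (φ : X ⟶ K.X n) :
    disk X n ⟶ K :=
  HomologicalComplex.mkHomFromDouble (show (ComplexShape.up ℤ).Rel n (n + 1) from rfl)
    (by simp) φ (φ ≫ K.d n (n + 1)) (by simp) (by simp)

@[simp]
lemma isoX_hom_desc_f {X : C} {n : ℤ} {K : CochainComplex C ℤ} (φ : X ⟶ K.X n) :
    (isoX X n).hom ≫ (desc φ).f n = φ := by
  dsimp [desc, isoX]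
  rw [HomologicalComplex.mkHomFromDouble_f₀]
  exact Iso.inv_hom_id_assoc _ _

@[simp]
lemma isoX_hom_desc_f_assoc {X Z : C} {n : ℤ} {K : CochainComplex C ℤ} (φ : X ⟶ K.X n)
    (ψ : K.X n ⟶ Z) : (isoX X n).hom ≫ (desc φ).f n ≫ ψ = φ ≫ ψ := by
  rw [← Category.assoc, isoX_hom_desc_f]

lemma hom_ext {X : C} {n : ℤ} {K : CochainComplex C ℤ} {f g : disk X n ⟶ K}
    (h : (isoX X n).hom ≫ f.f n = (isoX X n).hom ≫ g.f n) : f = g := by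
  rw [cancel_epi] at h
  refine HomologicalComplex.from_double_hom_ext h ?_
  change f.f (n + 1) = g.f (n + 1)
  rw [← cancel_epi ((disk X n).d n (n + 1)), ← f.comm, ← g.comm, h]

/-- The morphism between disk complexes induced by a morphism. -/
noncomputable def map {X Y : C} (f : X ⟶ Y) (n : ℤ) : disk X n ⟶ disk Y n :=
  desc (f ≫ (isoX Y n).hom)

instance {X Y : C} (f : X ⟶ Y) [Mono f] (n : ℤ) : Mono (map f n) := by
  have h₀ : Mono ((map f n).f n) := by
    rw [← (isoX X n).inv_hom_id_assoc ((map f n).f n), map, isoX_hom_desc_f]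
    infer_instance
  have (k : ℤ) : Mono ((map f n).f k) := by
    by_cases hk₀ : k = n
    · subst hk₀
      exact h₀
    · by_cases hk₁ : k = n + 1
      · subst hk₁
        rw [← IsIso.inv_hom_id_assoc ((disk X n).d n (n + 1)) ((map f n).f (n + 1)),
          ← (map f n).comm]
        infer_instance
      · exact (isZero_X X n k hk₀ hk₁).mono _
  exact HomologicalComplex.mono_of_mono_f _ this

lemma hasLiftingProperty_map_iff {X Y : C} (f : X ⟶ Y) (n : ℤ)
    {K L : CochainComplex C ℤ} (p : K ⟶ L) :
    HasLiftingProperty (map f n) p ↔ HasLiftingProperty f (p.f n) := by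
  constructor
  · refine fun _ ↦ ⟨fun {a b} sq ↦ ?_⟩
    have sq' : CommSq (desc a) (map f n) p (desc b) :=
      ⟨hom_ext (by simp [map, sq.w])⟩
    refine ⟨⟨{ l := (isoX Y n).hom ≫ sq'.lift.f n, fac_left := ?_, fac_right := ?_ }⟩⟩
    · have : f ≫ (isoX Y n).hom = (isoX X n).hom ≫ (map f n).f n := by simp [map]
      rw [reassoc_of% this, ← HomologicalComplex.comp_f, sq'.fac_left, isoX_hom_desc_f]
    · rw [Category.assoc, ← HomologicalComplex.comp_f, sq'.fac_right, isoX_hom_desc_f]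
  · refine fun _ ↦ ⟨fun {a b} sq ↦ ?_⟩
    have sq' : CommSq ((isoX X n).hom ≫ a.f n) f (p.f n) ((isoX Y n).hom ≫ b.f n) := by
      have := congrArg (fun q ↦ (isoX X n).hom ≫ q.f n) sq.w
      exact ⟨by simpa [map] using this⟩
    exact ⟨⟨{ l := desc sq'.lift
              fac_left := hom_ext (by simp [map])
              fac_right := hom_ext (by simp) }⟩⟩

end disk

open MorphismProperty

lemma rlp_monomorphisms_of_injective_of_isZero {D : Type u} [Category.{v} D] {X Y : D}
    (f : X ⟶ Y) [Injective X] (hY : IsZero Y) : (monomorphisms D).rlp f := by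
  rintro A B i (_ : Mono i)
  exact ⟨fun {a b} sq ↦ ⟨⟨{
    l := Injective.factorThru a i, fac_left := by simp, fac_right := hY.eq_of_tgt _ _ }⟩⟩⟩

instance (J : C) [Injective J] (n k : ℤ) : Injective ((disk J n).X k) := by
  by_cases hk₀ : k = n
  · subst hk₀
    exact Injective.of_iso (disk.isoX J k) inferInstance
  · by_cases hk₁ : k = n + 1
    · subst hk₁
      exact Injective.of_iso (disk.isoX J n ≪≫ asIso ((disk J n).d n (n + 1))) inferInstance
    · exact (disk.isZero_X J n k hk₀ hk₁).injective

/-- The projection from `disk J n` to the complex with `J` in degree `n`. -/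
noncomputable def diskToSingle (J : C) (n : ℤ) :
    disk J n ⟶ (HomologicalComplex.single C (ComplexShape.up ℤ) n).obj J :=
  disk.desc (HomologicalComplex.singleObjXSelf _ n J).inv

lemma diskToSingle_f (J : C) (n : ℤ) : (diskToSingle J n).f n =
    (disk.isoX J n).inv ≫ (HomologicalComplex.singleObjXSelf _ n J).inv := by
  rw [Iso.eq_inv_comp, diskToSingle, disk.isoX_hom_desc_f]

lemma diskToSingle_f_mem_rlp (J : C) [Injective J] (n k : ℤ) :
    (monomorphisms C).rlp ((diskToSingle J n).f k) := by
  by_cases hk : k = n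
  · subst hk
    have : IsIso ((diskToSingle J k).f k) := by
      rw [diskToSingle_f]
      infer_instance
    exact rlp_of_isIso _ _
  · exact rlp_monomorphisms_of_injective_of_isZero _
      (HomologicalComplex.isZero_single_obj_X _ _ _ _ hk)

end

section

variable {C : Type u} [Category.{v} C] [Abelian C]

open MorphismProperty

lemma exactAt_cokernel_of_llp {M W : CochainComplex C ℤ} (i : M ⟶ W)
    [EnoughInjectives C]
    (hi : ∀ ⦃K L : CochainComplex C ℤ⦄ (p : K ⟶ L),
      (∀ n, (monomorphisms C).rlp (p.f n)) → HasLiftingProperty i p) (n : ℤ) :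
    (cokernel i).ExactAt n := by
  obtain ⟨n, rfl⟩ : ∃ k, n = k + 1 := ⟨n - 1, by simp⟩
  rw [HomologicalComplex.exactAt_iff_isZero_homology]
  let Q := cokernel i
  let u : Q.homology (n + 1) ⟶ _ := Injective.ι (Q.homology (n + 1))
  obtain ⟨φ, hφ⟩ : ∃ φ : Q.X (n + 1) ⟶ Injective.under (Q.homology (n + 1)),
      Q.iCycles (n + 1) ≫ φ = Q.homologyπ (n + 1) ≫ u :=
    ⟨Injective.factorThru _ _, Injective.comp_factorThru _ _⟩
  have hφ' (k : ℤ) (hk : (ComplexShape.up ℤ).Rel k (n + 1)) : Q.d k (n + 1) ≫ φ = 0 := by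
    rw [← Q.toCycles_i, Category.assoc, hφ, Q.toCycles_comp_homologyπ_assoc, zero_comp]
  have := hi (diskToSingle _ (n + 1)) (diskToSingle_f_mem_rlp
    (Injective.under (Q.homology (n + 1))) (n + 1))
  have sq : CommSq (0 : M ⟶ _) i (diskToSingle (Injective.under (Q.homology (n + 1))) (n + 1))
      (cokernel.π i ≫ HomologicalComplex.mkHomToSingle φ hφ') := ⟨by simp⟩
  let k : Q ⟶ disk (Injective.under (Q.homology (n + 1))) (n + 1) :=
    cokernel.desc i sq.lift sq.fac_left
  have hk : k ≫ diskToSingle _ _ = HomologicalComplex.mkHomToSingle φ hφ' := by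
    rw [← cancel_epi (cokernel.π i), cokernel.π_desc_assoc]
    exact sq.fac_right
  have hφk : φ = k.f (n + 1) ≫ (disk.isoX _ _).inv := by
    have := congrArg (fun q ↦ q.f (n + 1)) hk
    rw [HomologicalComplex.comp_f, diskToSingle_f, HomologicalComplex.mkHomToSingle_f,
      ← Category.assoc, cancel_mono] at this
    exact this.symm
  have hcyc : Q.iCycles (n + 1) ≫ k.f (n + 1) = 0 := by
    rw [← cancel_mono ((disk _ (n + 1)).d (n + 1) (n + 1 + 1)), Category.assoc, k.comm]
    simp
  have hu : Q.homologyπ (n + 1) ≫ u = 0 := by rw [← hφ, hφk, reassoc_of% hcyc, zero_comp]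
  have hu' : u = 0 := by rwa [← cancel_epi (Q.homologyπ (n + 1)), comp_zero]
  exact IsZero.of_mono_eq_zero u hu'

variable [IsGrothendieckAbelian.{w} C]

lemma exists_mono_degreewise_injective (M : CochainComplex C ℤ) :
    ∃ (W : CochainComplex C ℤ) (i : M ⟶ W), Mono i ∧ (∀ n, Injective (W.X n)) ∧
      ∀ n, (cokernel i).ExactAt n := by
  let G := separator C
  let I : MorphismProperty (CochainComplex C ℤ) :=
    ofHoms (fun (k : ℤ × Subobject G) ↦ disk.map k.2.arrow k.1)
  have hI : I ≤ monomorphisms _ := by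
    rintro _ _ _ ⟨k⟩
    exact inferInstanceAs (Mono (disk.map k.2.arrow k.1))
  have : HasSmallObjectArgument.{w} I :=
    IsGrothendieckAbelian.hasSmallObjectArgument_ofHoms _
  let fac := (functorialFactorizationData I.rlp.llp I.rlp).factorizationData (0 : M ⟶ 0)
  refine ⟨fac.Z, fac.i, IsGrothendieckAbelian.mono_of_llp_rlp hI _ fac.hi, fun n ↦ ?_,
    exactAt_cokernel_of_llp fac.i fun K L p hp ↦ fac.hi _ ?_⟩
  · have hp : (monomorphisms C).rlp (fac.p.f n) := by
      rw [← IsGrothendieckAbelian.generatingMonomorphisms_rlp (isSeparator_separator C)]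
      rintro _ _ _ ⟨S⟩
      rw [← disk.hasLiftingProperty_map_iff]
      exact fac.hp _ ⟨(n, S)⟩
    refine ⟨fun {A B} g j _ ↦ ?_⟩
    have := hp j (inferInstanceAs (Mono j))
    have sq : CommSq g j (fac.p.f n) 0 := ⟨by
      have : fac.p = 0 := (isZero_zero _).eq_of_tgt _ _
      simp [this]⟩
    exact ⟨sq.lift, sq.fac_left⟩
  · rintro _ _ _ ⟨n, S⟩
    rw [disk.hasLiftingProperty_map_iff]
    exact hp n _ (inferInstanceAs (Mono S.arrow))

end

section

variable {C : Type u} [Category.{v} C] [Abelian C]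

open HomologicalComplex Pretriangulated

lemma CochainComplex.quasiIso_of_exactAt_cokernel {M W : CochainComplex C ℤ} (i : M ⟶ W) [Mono i]
    (hi : ∀ n, (cokernel i).ExactAt n) : QuasiIso i := by
  have hS : (ShortComplex.mk i (cokernel.π i) (cokernel.condition i)).ShortExact :=
    { exact := ShortComplex.exact_of_g_is_cokernel _ (cokernelIsCokernel i) }
  refine ⟨fun n ↦ ?_⟩
  rw [quasiIsoAt_iff_isIso_homologyMap]
  have hz (k : ℤ) : IsZero ((cokernel i).homology k) := (hi k).isZero_homology
  have : Epi (homologyMap i n) := (hS.homology_exact₂ n).epi_f ((hz n).eq_of_tgt _ _)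
  have : Mono (homologyMap i n) :=
    (hS.homology_exact₁ (n - 1) n (by simp)).mono_g ((hz _).eq_of_src _ _)
  exact isIso_of_mono_of_epi _

lemma CochainComplex.exactAt_mappingCone {M W : CochainComplex C ℤ} (g : M ⟶ W) [QuasiIso g]
    (n : ℤ) : (mappingCone g).ExactAt n := by
  revert n
  rw [← HomotopyCategory.quotient_obj_mem_subcategoryAcyclic_iff_exactAt]
  refine ((HomotopyCategory.subcategoryAcyclic C).trW_iff_of_distinguished _
    (HomotopyCategory.mappingCone_triangleh_distinguished g)).1 ?_
  rw [← HomotopyCategory.quasiIso_eq_trW_subcategoryAcyclic]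
  exact (HomotopyCategory.quotient_map_mem_quasiIso_iff g).2 (by simpa)

lemma CochainComplex.quasiIso_inr_mappingCone {X Y : CochainComplex C ℤ} (f : X ⟶ Y)
    (hX : ∀ n, X.ExactAt n) : QuasiIso (mappingCone.inr f) := by
  rw [← HomologicalComplex.mem_quasiIso_iff, ← HomotopyCategory.quotient_map_mem_quasiIso_iff,
    HomotopyCategory.quasiIso_eq_trW_subcategoryAcyclic]
  exact ((HomotopyCategory.subcategoryAcyclic C).trW_iff_of_distinguished' _
    (HomotopyCategory.mappingCone_triangleh_distinguished f)).2
    ((HomotopyCategory.quotient_obj_mem_subcategoryAcyclic_iff_exactAt X).2 hX)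

lemma IsCotorsionPair.mappingCone_X_mem_right [HasExt.{w} C] {𝒜 ℬ : Set C}
    (hcp : IsCotorsionPair C 𝒜 ℬ) {K L : CochainComplex C ℤ} (g : K ⟶ L)
    (hK : ∀ n, K.X n ∈ ℬ) (hL : ∀ n, L.X n ∈ ℬ) (n : ℤ) :
    (CochainComplex.mappingCone g).X n ∈ ℬ := by
  have s : (ShortComplex.mk ((CochainComplex.mappingCone.inr g).f n)
      ((CochainComplex.mappingCone.fst g).1.v n (n + 1) rfl) (by simp)).Splitting :=
    { r := (CochainComplex.mappingCone.snd g).v n n (add_zero n)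
      s := (CochainComplex.mappingCone.inl g).v (n + 1) n (by simp)
      f_r := by simp
      s_g := by simp
      id := (add_comm _ _).trans (CochainComplex.mappingCone.id_X g n (n + 1) rfl) }
  exact hcp.right_X₂ s.shortExact (hL n) (hK (n + 1))

/-- A morphism to `Y` which becomes null-homotopic after composition with `g : Y ⟶ W`
factors, up to homotopy, through the desuspension of the cone of `g`. -/
lemma CochainComplex.exists_fac_shift_mappingCone {X Y W : CochainComplex C ℤ} (f : X ⟶ Y)
    (g : Y ⟶ W) (h : Nonempty (Homotopy (f ≫ g) 0)) :
    ∃ (a : X ⟶ (mappingCone g)⟦(-1 : ℤ)⟧) (b : (mappingCone g)⟦(-1 : ℤ)⟧ ⟶ Y),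
      Nonempty (Homotopy f (a ≫ b)) := by
  let q := HomotopyCategory.quotient C (ComplexShape.up ℤ)
  let m : (q.obj (mappingCone g))⟦(-1 : ℤ)⟧ ⟶ q.obj Y :=
    (mappingCone.triangleh g).invRotate.mor₁
  obtain ⟨a, ha⟩ : ∃ a : q.obj X ⟶ (q.obj (mappingCone g))⟦(-1 : ℤ)⟧, q.map f = a ≫ m :=
    Triangle.coyoneda_exact₂ _ (inv_rot_of_distTriang _
      (HomotopyCategory.mappingCone_triangleh_distinguished g)) (q.map f)
      ((q.map_comp f g).symm.trans ((HomotopyCategory.quotient_map_eq_zero_iff _).2 h))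
  let e : q.obj ((mappingCone g)⟦(-1 : ℤ)⟧) ≅ (q.obj (mappingCone g))⟦(-1 : ℤ)⟧ :=
    (q.commShiftIso (-1 : ℤ)).app _
  obtain ⟨a', ha'⟩ := q.map_surjective (a ≫ e.inv)
  obtain ⟨b', hb'⟩ : ∃ b' : (mappingCone g)⟦(-1 : ℤ)⟧ ⟶ Y, q.map b' = e.hom ≫ m :=
    q.map_surjective _
  refine ⟨a', b', ⟨HomotopyCategory.homotopyOfEq _ _
    (ha.trans (Eq.trans ?_ (q.map_comp a' b').symm))⟩⟩
  rw [ha', hb', Category.assoc, e.inv_hom_id_assoc]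

lemma CochainComplex.exactAt_shift {K : CochainComplex C ℤ} (hK : ∀ n, K.ExactAt n) (m n : ℤ) :
    (K⟦m⟧).ExactAt n := by
  revert n
  rw [← HomotopyCategory.quotient_obj_mem_subcategoryAcyclic_iff_exactAt]
  exact (HomotopyCategory.subcategoryAcyclic C).prop_of_iso
    (((HomotopyCategory.quotient C (ComplexShape.up ℤ)).commShiftIso m).app K).symm
    ((HomotopyCategory.subcategoryAcyclic C).le_shift m _
      ((HomotopyCategory.quotient_obj_mem_subcategoryAcyclic_iff_exactAt K).2 hK))

lemma IsCotorsionPair.nonempty_homotopy_zero_of_cycles_mem [IsGrothendieckAbelian.{w'} C]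
    [HasExt.{w} C] {𝒜 ℬ : Set C} (hcp : IsCotorsionPair C 𝒜 ℬ)
    (H : ∀ Y : CochainComplex C ℤ, (∀ n, Y.ExactAt n) → (∀ n, Y.X n ∈ ℬ) → ∀ n, Y.cycles n ∈ ℬ)
    {X Y : CochainComplex C ℤ} (hY : ∀ n, Y.X n ∈ ℬ) (hX : ∀ n, X.ExactAt n)
    (hXA : ∀ n, X.cycles n ∈ 𝒜) (f : X ⟶ Y) : Nonempty (Homotopy f 0) := by
  obtain ⟨W, i, _, hW, hi⟩ :=
    exists_mono_degreewise_injective.{w'} (CochainComplex.mappingCone f)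
  have := CochainComplex.quasiIso_of_exactAt_cokernel i hi
  have := CochainComplex.quasiIso_inr_mappingCone f hX
  let g := CochainComplex.mappingCone.inr f ≫ i
  have hg : QuasiIso g := inferInstanceAs (QuasiIso (_ ≫ _))
  have hfg : Nonempty (Homotopy (f ≫ g) 0) := by
    have h₀ := comp_distTriang_mor_zero₁₂ _
      (HomotopyCategory.mappingCone_triangleh_distinguished f)
    obtain ⟨h₀⟩ := (HomotopyCategory.quotient_map_eq_zero_iff
      (f ≫ CochainComplex.mappingCone.inr f)).1 ((Functor.map_comp _ _ _).trans h₀)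
    exact ⟨(Homotopy.ofEq (Category.assoc _ _ _).symm).trans
      ((h₀.compRight i).trans (Homotopy.ofEq zero_comp))⟩
  obtain ⟨a, b, ⟨hab⟩⟩ := CochainComplex.exists_fac_shift_mappingCone f g hfg
  have hN := CochainComplex.exactAt_shift (CochainComplex.exactAt_mappingCone g) (-1)
  obtain ⟨ha⟩ := hcp.nonempty_homotopy_zero hX hXA hN (H _ hN fun n ↦
    hcp.mappingCone_X_mem_right g hY (fun n ↦ have := hW n; hcp.right_of_injective) (n + -1)) a
  exact ⟨hab.trans ((ha.compRight b).trans (Homotopy.ofEq zero_comp))⟩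

end

/-- for a complete hereditary cotorsion pair `(𝒜, ℬ)` in a Grothendieck category,
`exℬ = ℬ~` if and only if `dwℬ = dgℬ`. -/
theorem stmt7 (C : Type u) [Category.{v} C] [Abelian C]
    [HasFilteredColimits C] [AB5 C] [HasSeparator C]
    [HasExt.{w} C]
    (𝒜 ℬ : Set C) (hcp : IsCompleteHereditaryCotorsionPair C 𝒜 ℬ) :
    -- (i) every acyclic complex with components in `ℬ` has all its cycles in `ℬ` ...
    (∀ Y : CochainComplex C ℤ,
      (∀ n : ℤ, Y.ExactAt n) → (∀ n : ℤ, Y.X n ∈ ℬ) → ∀ n : ℤ, Y.cycles n ∈ ℬ) ↔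
    -- ... iff (ii) every chain map from a complex in `𝒜~` to a complex in `dwℬ`
    -- is null-homotopic:
    (∀ Y : CochainComplex C ℤ, (∀ n : ℤ, Y.X n ∈ ℬ) →
      ∀ X : CochainComplex C ℤ, (∀ n : ℤ, X.ExactAt n) → (∀ n : ℤ, X.X n ∈ 𝒜) →
        (∀ n : ℤ, X.cycles n ∈ 𝒜) → ∀ f : X ⟶ Y, Nonempty (Homotopy f 0)) := by
  have : IsGrothendieckAbelian.{v} C := { }
  exact ⟨fun H Y hY X hX _ hXA f ↦
      hcp.toIsCotorsionPair.nonempty_homotopy_zero_of_cycles_mem H hY hX hXA f,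
    fun H Y hY hYB ↦ cycles_mem_right_of_nullhomotopic hcp hY hYB (H Y hYB)⟩
end
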